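/- Let d ≥ 1, s ∈ (0,1), and define u : ℝ^d → ℝ by u(x) := λ (1−|x|²)_+^s with λ := Γ(d/2)/(2^{2s} Γ((d+2s)/2) Γ(1+s)), where t_+ = max{t,0}. Then for every x in the open unit ball B(0,1), the principal value C_{d,s} lim_{ε→0⁺} ∫_{{y ∈ ℝ^d : |x−y| > ε}} (u(x)−u(y))/|x−y|^{d+2s} dy exists and equals 1. In other words, u solves (−Δ)^s u = 1 in B(0,1) with u = 0 in ℝ^d \ B(0,1). -/

import Mathlib

open MeasureTheory ENNReal Set Filter

noncomputable section

/-- The normalization constant `C_{d,s}` of the integral fractional Laplacian. -/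
def Cds (d : ℕ) (s : ℝ) : ℝ :=
  2 ^ (2 * s) * s * Real.Gamma (s + d / 2) /
    (Real.pi ^ ((d : ℝ) / 2) * Real.Gamma (1 - s))

/-- The explicit solution `u(x) = λ (1-|x|²)₊^s` of `(-Δ)^s u = 1` in `B(0,1)`. -/
def getoorFun (d : ℕ) (s : ℝ) (x : EuclideanSpace ℝ (Fin d)) : ℝ :=
  Real.Gamma (d / 2) / (2 ^ (2 * s) * Real.Gamma ((d + 2 * s) / 2) * Real.Gamma (1 + s)) *
    (max (1 - ‖x‖ ^ 2) 0) ^ s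

/-- The power `w₊ ^ p` of the positive part of `w`. -/
def posPow (p w : ℝ) : ℝ := (max w 0) ^ p

lemma posPow_nonneg (p w : ℝ) : 0 ≤ posPow p w := Real.rpow_nonneg (le_max_right _ _) _

lemma posPow_of_nonneg {w : ℝ} (p : ℝ) (hw : 0 ≤ w) : posPow p w = w ^ p := by
  rw [posPow, max_eq_left hw]

lemma posPow_of_nonpos {p w : ℝ} (hp : p ≠ 0) (hw : w ≤ 0) : posPow p w = 0 := by
  rw [posPow, max_eq_right hw, Real.zero_rpow hp]

lemma posPow_le_posPow {p v w : ℝ} (hp : 0 ≤ p) (h : v ≤ w) : posPow p v ≤ posPow p w :=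
  Real.rpow_le_rpow (le_max_right _ _) (max_le_max_right _ h) hp

lemma posPow_le_rpow {p v w : ℝ} (hp : p ≤ 0) (hv : 0 < v) (h : v ≤ w) : posPow p w ≤ v ^ p := by
  rw [posPow_of_nonneg p (hv.le.trans h)]
  exact Real.rpow_le_rpow_of_nonpos hv h hp

lemma posPow_mul {p a : ℝ} (ha : 0 ≤ a) (w : ℝ) : posPow p (a * w) = a ^ p * posPow p w := by
  rw [posPow, posPow, ← Real.mul_rpow ha (le_max_right _ _), mul_max_of_nonneg _ _ ha, mul_zero]

lemma continuous_posPow {p : ℝ} (hp : 0 ≤ p) : Continuous (posPow p) :=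
  (continuous_id.max continuous_const).rpow_const fun _ => Or.inr hp

lemma measurable_posPow (p : ℝ) : Measurable (posPow p) := by
  unfold posPow; fun_prop

lemma hasDerivAt_posPow {p w : ℝ} (hp : p ≠ 0) (hp' : p - 1 ≠ 0) (hw : w ≠ 0) :
    HasDerivAt (posPow p) (p * posPow (p - 1) w) w := by
  rcases lt_or_gt_of_ne hw with h | h
  · rw [posPow_of_nonpos hp' h.le, mul_zero]
    refine (hasDerivAt_const w (0 : ℝ)).congr_of_eventuallyEq ?_
    filter_upwards [Iio_mem_nhds h] with y hy using posPow_of_nonpos hp (le_of_lt hy)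
  · rw [posPow_of_nonneg _ h.le]
    refine (Real.hasDerivAt_rpow_const (Or.inl hw)).congr_of_eventuallyEq ?_
    filter_upwards [Ioi_mem_nhds h] with y hy using posPow_of_nonneg p (le_of_lt hy)

lemma intervalIntegrable_posPow {p : ℝ} (hp : -1 < p) (hp' : p ≠ 0) (a b : ℝ) :
    IntervalIntegrable (posPow p) volume a b := by
  have h : posPow p = (Ioi (0 : ℝ)).indicator fun w => w ^ p := by
    ext w
    by_cases hw : 0 < w
    · rw [indicator_of_mem (by exact hw), posPow_of_nonneg p hw.le]
    · rw [indicator_of_notMem (by exact hw), posPow_of_nonpos hp' (not_lt.1 hw)]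
  have h2 := intervalIntegral.intervalIntegrable_rpow' (a := a) (b := b) hp
  rw [h]
  rw [intervalIntegrable_iff] at h2 ⊢
  exact h2.indicator measurableSet_Ioi

lemma integral_posPow_sub_one {s : ℝ} (hs : s ∈ Ioo (0 : ℝ) 1) (a b : ℝ) :
    ∫ w in a..b, s * posPow (s - 1) w = posPow s b - posPow s a := by
  have h1 : s - 1 ≠ 0 := by linarith [hs.2]
  refine MeasureTheory.integral_eq_of_hasDerivAt_off_countable _ _ (countable_singleton 0)
    (continuous_posPow hs.1.le).continuousOn (fun x hx => ?_) ?_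
  · exact hasDerivAt_posPow hs.1.ne' h1 hx.2
  · exact (intervalIntegrable_posPow (by linarith [hs.1]) h1 a b).const_mul s

lemma integral_posPow_affine {s : ℝ} (hs : s ∈ Ioo (0 : ℝ) 1) (A a b : ℝ) {t : ℝ} (ht : 0 < t) :
    ∫ c in a..b, posPow (s - 1) (A + c * t) =
      s⁻¹ * ((posPow s (A + b * t) - posPow s (A + a * t)) / t) := by
  have h := intervalIntegral.integral_comp_add_mul (a := a) (b := b)
    (fun w => s * posPow (s - 1) w) ht.ne' A
  rw [integral_posPow_sub_one hs, intervalIntegral.integral_const_mul] at h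
  simp only [mul_comm _ t]
  rw [eq_inv_mul_iff_mul_eq₀ hs.1.ne', h, smul_eq_mul]
  ring

lemma intervalIntegrable_posPow_affine {p : ℝ} (hp : -1 < p) (hp' : p ≠ 0) (A a b t : ℝ) :
    IntervalIntegrable (fun c => posPow p (A + c * t)) volume a b := by
  rcases eq_or_ne t 0 with rfl | ht
  · simp
  have h := ((intervalIntegrable_posPow hp hp' (A + a * t) (A + b * t)).comp_mul_left (c := t)
    |>.comp_add_left (A / t))
  convert h using 1
  · ext c; congr 1; field_simp
  · field_simp; ring
  · field_simp; ring

/-- The fraction `w₊ ^ s / t`, with `w = D t² + c t - 1`, vanishes near `t = 0`. -/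
lemma continuous_posPow_div {s D : ℝ} (hs : 0 < s) (c : ℝ) :
    Continuous fun t : ℝ => posPow s (D * t ^ 2 + c * t - 1) / t := by
  rw [continuous_iff_continuousAt]
  intro t
  have hc : Continuous fun t : ℝ => D * t ^ 2 + c * t - 1 := by fun_prop
  rcases eq_or_ne t 0 with rfl | ht
  · refine (continuousAt_const (y := (0 : ℝ))).congr ?_
    have : ∀ᶠ t in nhds (0 : ℝ), D * t ^ 2 + c * t - 1 < 0 :=
      hc.continuousAt.eventually_lt continuousAt_const (by norm_num)
    filter_upwards [this] with t ht
    rw [posPow_of_nonpos hs.ne' ht.le, zero_div]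
  · exact ((continuous_posPow hs.le).comp hc).continuousAt.div continuousAt_id ht

/-- The truncated integral obtained from `∫_{r > ε} (D + c r - r²)₊ ^ s r ^ (-1 - 2 s) dr`
by the inversion `t = 1 / r`. -/
def chordIntegral (s D T c : ℝ) : ℝ := ∫ t in 0..T, posPow s (D * t ^ 2 + c * t - 1) / t

/-- Up to the factor `s`, the derivative of `chordIntegral` in its last argument. -/
def chordDeriv (s D T c : ℝ) : ℝ := ∫ t in 0..T, posPow (s - 1) (D * t ^ 2 + c * t - 1)

lemma integrable_chord {s D : ℝ} (hs : s ∈ Ioo (0 : ℝ) 1) (T : ℝ) (a b : ℝ)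
    (hab : a ≤ b) :
    Integrable (Function.uncurry fun t c : ℝ => posPow (s - 1) (D * t ^ 2 + c * t - 1))
      ((volume.restrict (Ioc 0 T)).prod (volume.restrict (Ioc a b))) := by
  have hm : Measurable (Function.uncurry fun t c : ℝ => posPow (s - 1) (D * t ^ 2 + c * t - 1)) :=
    (measurable_posPow _).comp (by fun_prop)
  have h1 : s - 1 ≠ 0 := by linarith [hs.2]
  have h2 : -1 < s - 1 := by linarith [hs.1]
  rw [integrable_prod_iff hm.aestronglyMeasurable]
  constructor
  · refine ae_of_all _ fun t => ?_
    have := (intervalIntegrable_posPow_affine h2 h1 (D * t ^ 2 - 1) a b t).1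
    refine this.congr (ae_of_all _ fun c => ?_)
    simp only [Function.uncurry]
    congr 1; ring
  · have hi : IntegrableOn (fun t : ℝ => s⁻¹ * (posPow s (D * t ^ 2 + b * t - 1) / t -
        posPow s (D * t ^ 2 + a * t - 1) / t)) (Ioc 0 T) := by
      have : Continuous (fun t : ℝ => s⁻¹ * (posPow s (D * t ^ 2 + b * t - 1) / t -
        posPow s (D * t ^ 2 + a * t - 1) / t)) :=
        continuous_const.mul ((continuous_posPow_div hs.1 b).sub (continuous_posPow_div hs.1 a))
      exact (this.integrableOn_Icc (a := 0) (b := T)).mono_set Ioc_subset_Icc_self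
    refine hi.congr ?_
    filter_upwards [ae_restrict_mem measurableSet_Ioc] with t ht
    have h3 := integral_posPow_affine hs (D * t ^ 2 - 1) a b ht.1
    rw [intervalIntegral.integral_of_le hab] at h3
    simp only [Function.uncurry, Real.norm_of_nonneg (posPow_nonneg _ _)]
    have e : ∀ c : ℝ, D * t ^ 2 + c * t - 1 = D * t ^ 2 - 1 + c * t := fun c => by ring
    simp only [e]
    rw [h3, sub_div]

lemma chordIntegral_sub {s D T : ℝ} (hs : s ∈ Ioo (0 : ℝ) 1) (hT : 0 ≤ T) {a b : ℝ}
    (hab : a ≤ b) :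
    IntervalIntegrable (chordDeriv s D T) volume a b ∧
    chordIntegral s D T b - chordIntegral s D T a = s * ∫ c in a..b, chordDeriv s D T c := by
  have hi := integrable_chord (D := D) hs T a b hab
  constructor
  · rw [intervalIntegrable_iff_integrableOn_Ioc_of_le hab]
    refine hi.integral_prod_right.congr (ae_of_all _ fun c => ?_)
    simp [chordDeriv, intervalIntegral.integral_of_le hT]
  have h := integral_integral_swap hi
  simp only [chordDeriv, chordIntegral]
  rw [← intervalIntegral.integral_sub
    ((continuous_posPow_div hs.1 b).intervalIntegrable _ _)
    ((continuous_posPow_div hs.1 a).intervalIntegrable _ _)]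
  simp only [intervalIntegral.integral_of_le hT, intervalIntegral.integral_of_le hab]
  rw [← h, ← integral_const_mul]
  refine setIntegral_congr_fun measurableSet_Ioc fun t ht => ?_
  have h3 := integral_posPow_affine hs (D * t ^ 2 - 1) a b ht.1
  rw [intervalIntegral.integral_of_le hab] at h3
  have e : ∀ c : ℝ, D * t ^ 2 + c * t - 1 = D * t ^ 2 - 1 + c * t := fun c => by ring
  simp only [e]
  rw [h3, mul_inv_cancel_left₀ hs.1.ne', sub_div]

lemma intervalIntegrable_posPow_quadratic {s D R : ℝ} (hs : s ∈ Ioo (0 : ℝ) 1) (hD : 0 < D)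
    (hR : 0 < R) (a b : ℝ) :
    IntervalIntegrable (fun τ => posPow (s - 1) (D * τ ^ 2 - R)) volume a b := by
  have h1 : s - 1 ≠ 0 := by linarith [hs.2]
  have h2 : -1 < s - 1 := by linarith [hs.1]
  set ρ := √(R / D) with hρ
  have hρ0 : 0 < ρ := Real.sqrt_pos.2 (div_pos hR hD)
  have hρR : R = D * ρ ^ 2 := by
    rw [hρ, Real.sq_sqrt (div_pos hR hD).le]; field_simp
  have hi := ((intervalIntegrable_posPow_affine h2 h1 (-ρ) a b 1).add
    (intervalIntegrable_posPow_affine h2 h1 (-ρ) a b (-1))).const_mul ((D * ρ) ^ (s - 1))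
  have key : ∀ τ : ℝ, 0 ≤ τ → posPow (s - 1) (D * τ ^ 2 - R) ≤
      (D * ρ) ^ (s - 1) * posPow (s - 1) (-ρ + τ) := by
    intro τ hτ
    rcases le_or_gt τ ρ with h | h
    · rw [posPow_of_nonpos h1]
      · exact mul_nonneg (by positivity) (posPow_nonneg _ _)
      · rw [hρR, ← mul_sub]
        exact mul_nonpos_of_nonneg_of_nonpos hD.le (by nlinarith)
    · rw [← posPow_mul (by positivity), posPow_of_nonneg _ (w := D * ρ * (-ρ + τ))
        (mul_nonneg (by positivity) (by linarith))]
      refine posPow_le_rpow (by linarith [hs.2]) (mul_pos (by positivity) (by linarith)) ?_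
      rw [hρR]
      nlinarith [mul_nonneg hD.le (mul_nonneg hτ (sub_nonneg.2 h.le))]
  refine hi.mono_fun' ((measurable_posPow _).comp (by fun_prop)).aestronglyMeasurable
    (ae_of_all _ fun τ => ?_)
  have hC : 0 ≤ (D * ρ) ^ (s - 1) := by positivity
  have e1 := mul_nonneg hC (posPow_nonneg (s - 1) (-ρ + τ))
  have e2 := mul_nonneg hC (posPow_nonneg (s - 1) (-ρ + -τ))
  simp only [Real.norm_of_nonneg (posPow_nonneg _ _), mul_one, mul_neg, mul_add]
  rcases le_total 0 τ with h | h
  · linarith [key τ h]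
  · have := key (-τ) (by linarith)
    rw [neg_sq] at this
    linarith

lemma abs_chordDeriv_sub_neg_le {s D T c : ℝ} (hs : s ∈ Ioo (0 : ℝ) 1) (hD : 0 < D)
    (hc0 : 0 ≤ c) (hc2 : c ≤ 2) (hT : 1 / D ≤ T)
    (hQ : 0 < D * (T - 1 / D) ^ 2 - (1 + 1 / D)) :
    |chordDeriv s D T c - chordDeriv s D T (-c)| ≤
      (D * (T - 1 / D) ^ 2 - (1 + 1 / D)) ^ (s - 1) * (2 / D) := by
  have h1 : s - 1 ≠ 0 := by linarith [hs.2]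
  set m := c / (2 * D) with hm
  set R := 1 + c ^ 2 / (4 * D) with hR
  have hm0 : 0 ≤ m := by positivity
  have hm1 : m ≤ 1 / D := by
    rw [hm, div_le_div_iff₀ (by positivity) hD]; nlinarith
  have hR1 : R ≤ 1 + 1 / D := by
    have : c ^ 2 / (4 * D) ≤ 1 / D := by
      rw [div_le_div_iff₀ (by positivity) hD]; nlinarith [mul_nonneg hc0 (sub_nonneg.2 hc2)]
    linarith
  have hDm : D * m ^ 2 = R - 1 := by rw [hm, hR]; field_simp; ring
  have hR0 : 0 < R := by positivity
  set q : ℝ → ℝ := fun τ => posPow (s - 1) (D * τ ^ 2 - R) with hq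
  have hi := intervalIntegrable_posPow_quadratic hs hD hR0
  have ep : chordDeriv s D T c = ∫ τ in m..T + m, q τ := by
    have := intervalIntegral.integral_comp_add_right (a := 0) (b := T) q m
    rw [zero_add] at this
    rw [← this, chordDeriv]
    congr 1; ext t; simp only [hq]; congr 1
    rw [hm, hR]; field_simp; ring
  have en : chordDeriv s D T (-c) = ∫ τ in -m..T - m, q τ := by
    have := intervalIntegral.integral_comp_add_right (a := 0) (b := T) q (-m)
    rw [zero_add, ← sub_eq_add_neg] at this
    rw [← this, chordDeriv]
    congr 1; ext t; simp only [hq]; congr 1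
    rw [hm, hR]; field_simp; ring
  have hz : ∫ τ in -m..m, q τ = 0 := by
    rw [intervalIntegral.integral_congr (g := fun _ => 0)]
    · simp
    · intro τ hτ
      rw [uIcc_of_le (by linarith)] at hτ
      refine posPow_of_nonpos h1 ?_
      have : τ ^ 2 ≤ m ^ 2 := sq_le_sq' hτ.1 hτ.2
      nlinarith
  rw [ep, en, intervalIntegral.integral_interval_sub_interval_comm' (hi _ _) (hi _ _) (hi _ _), hz,
    sub_zero]
  have hb := intervalIntegral.norm_integral_le_of_norm_le_const (a := T - m) (b := T + m) (f := q)
    (C := (D * (T - 1 / D) ^ 2 - (1 + 1 / D)) ^ (s - 1)) (fun τ hτ => by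
      rw [uIoc_of_le (by linarith)] at hτ
      rw [Real.norm_of_nonneg (posPow_nonneg _ _)]
      refine posPow_le_rpow (by linarith [hs.2]) hQ ?_
      have : (T - 1 / D) ^ 2 ≤ τ ^ 2 := by
        apply pow_le_pow_left₀ (by linarith); linarith [hτ.1]
      nlinarith)
  rw [Real.norm_eq_abs] at hb
  refine hb.trans (mul_le_mul_of_nonneg_left ?_ (by positivity))
  rw [abs_of_nonneg (by linarith)]
  have : 2 / D = 2 * (1 / D) := by ring
  linarith

lemma abs_chordIntegral_symm_le {s D T c : ℝ} (hs : s ∈ Ioo (0 : ℝ) 1) (hD : 0 < D)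
    (hc : |c| ≤ 2) (hT : 1 / D ≤ T) (hQ : 0 < D * (T - 1 / D) ^ 2 - (1 + 1 / D)) :
    |chordIntegral s D T c + chordIntegral s D T (-c) - 2 * chordIntegral s D T 0| ≤
      4 / D * (D * (T - 1 / D) ^ 2 - (1 + 1 / D)) ^ (s - 1) := by
  wlog hc0 : 0 ≤ c generalizing c
  · have := this (c := -c) (by rwa [abs_neg]) (by linarith)
    rwa [neg_neg, add_comm (chordIntegral s D T (-c))] at this
  rw [abs_of_nonneg hc0] at hc
  have hT0 : 0 ≤ T := le_trans (by positivity) hT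
  obtain ⟨hi1, h1⟩ := chordIntegral_sub (D := D) hs hT0 hc0
  obtain ⟨hi2, h2⟩ := chordIntegral_sub (D := D) hs hT0 (neg_nonpos.2 hc0)
  have hi3 : IntervalIntegrable (fun x => chordDeriv s D T (-x)) volume 0 c := by
    have := (IntervalIntegrable.iff_comp_neg (a := -c) (b := 0) (f := chordDeriv s D T)).1 hi2
    simpa using this.symm
  have e2 : ∫ x in -c..0, chordDeriv s D T x = ∫ x in 0..c, chordDeriv s D T (-x) := by
    rw [intervalIntegral.integral_comp_neg, neg_zero]
  have e : chordIntegral s D T c + chordIntegral s D T (-c) - 2 * chordIntegral s D T 0 =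
      s * ∫ x in 0..c, (chordDeriv s D T x - chordDeriv s D T (-x)) := by
    rw [intervalIntegral.integral_sub hi1 hi3, mul_sub, ← h1, ← e2, ← h2]; ring
  set Q := D * (T - 1 / D) ^ 2 - (1 + 1 / D)
  have hb := intervalIntegral.norm_integral_le_of_norm_le_const (a := 0) (b := c)
    (f := fun x => chordDeriv s D T x - chordDeriv s D T (-x))
    (C := Q ^ (s - 1) * (2 / D)) (fun x hx => by
      rw [uIoc_of_le hc0] at hx
      exact abs_chordDeriv_sub_neg_le hs hD hx.1.le (hx.2.trans hc) hT hQ)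
  rw [Real.norm_eq_abs, sub_zero, abs_of_nonneg hc0] at hb
  rw [e, abs_mul, abs_of_pos hs.1]
  have hB : 0 ≤ Q ^ (s - 1) * (2 / D) := by positivity
  calc s * |∫ x in 0..c, (chordDeriv s D T x - chordDeriv s D T (-x))|
      ≤ 1 * (Q ^ (s - 1) * (2 / D) * 2) :=
        mul_le_mul hs.2.le (hb.trans (mul_le_mul_of_nonneg_left hc hB)) (abs_nonneg _) zero_le_one
    _ = 4 / D * Q ^ (s - 1) := by ring

lemma integral_Ioi_posPow_eq_chordIntegral (s D c : ℝ) {ε : ℝ} (hε : 0 < ε) :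
    ∫ r in Ioi ε, posPow s (D + c * r - r ^ 2) * r ^ (-1 - 2 * s) = chordIntegral s D (1 / ε) c := by
  set g : ℝ → ℝ := (Ioi ε).indicator fun r => posPow s (D + c * r - r ^ 2) * r ^ (-1 - 2 * s)
    with hg
  have h := integral_comp_rpow_Ioi g (p := -1) (by norm_num)
  have e : ∫ r in Ioi (0 : ℝ), g r =
      ∫ r in Ioi ε, posPow s (D + c * r - r ^ 2) * r ^ (-1 - 2 * s) := by
    rw [hg, setIntegral_indicator measurableSet_Ioi, inter_eq_right.2 (Ioi_subset_Ioi hε.le)]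
  have eI : Ioi (0 : ℝ) ∩ Ioo 0 (1 / ε) = Ioo 0 (1 / ε) := inter_eq_right.2 Ioo_subset_Ioi_self
  rw [← e, ← h, chordIntegral, intervalIntegral.integral_of_le (by positivity),
    integral_Ioc_eq_integral_Ioo, ← eI, ← setIntegral_indicator measurableSet_Ioo]
  refine setIntegral_congr_fun measurableSet_Ioi fun t (ht : 0 < t) => ?_
  simp only [hg, Real.rpow_neg_one, smul_eq_mul]
  by_cases hlt : t < 1 / ε
  · have hlt' : ε < t⁻¹ := by rw [lt_inv_comm₀ hε ht]; simpa using hlt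
    rw [indicator_of_mem (by exact hlt'), indicator_of_mem (by exact ⟨ht, hlt⟩)]
    have e1 : D + c * t⁻¹ - t⁻¹ ^ 2 = (t ^ (-2 : ℝ)) * (D * t ^ 2 + c * t - 1) := by
      rw [Real.rpow_neg ht.le]; norm_cast; field_simp
    rw [e1, posPow_mul (by positivity), ← Real.rpow_mul ht.le, Real.inv_rpow ht.le,
      ← Real.rpow_neg ht.le]
    have e2 : t ^ (-1 - 1 : ℝ) * t ^ (-2 * s) * t ^ (-(-1 - 2 * s)) = t⁻¹ := by
      rw [← Real.rpow_add ht, ← Real.rpow_add ht, ← Real.rpow_neg_one]; congr 1; ring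
    rw [div_eq_mul_inv, ← e2]
    norm_num
    ring
  · have hlt' : ¬ ε < t⁻¹ := by rw [lt_inv_comm₀ hε ht]; simpa using hlt
    rw [indicator_of_notMem (by exact hlt'), indicator_of_notMem (by exact fun h => hlt h.2),
      mul_zero]

lemma integrableOn_posPow_mul_rpow {s : ℝ} (hs : 0 < s) (D c : ℝ) {ε : ℝ} (hε : 0 < ε) :
    IntegrableOn (fun r => posPow s (D + c * r - r ^ 2) * r ^ (-1 - 2 * s)) (Ioi ε) := by
  have h := (integrableOn_Ioi_rpow_of_lt (a := -1 - 2 * s) (by linarith) hε).const_mul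
    (posPow s (D + c ^ 2 / 4))
  refine h.mono' (Measurable.aestronglyMeasurable ?_) ?_
  · exact ((measurable_posPow s).comp (by fun_prop)).mul (by fun_prop)
  · filter_upwards [ae_restrict_mem measurableSet_Ioi] with r hr
    have hr0 : 0 ≤ r := hε.le.trans (le_of_lt hr)
    rw [Real.norm_of_nonneg (mul_nonneg (posPow_nonneg _ _) (by positivity))]
    refine mul_le_mul_of_nonneg_right (posPow_le_posPow hs.le ?_) (by positivity)
    nlinarith [sq_nonneg (r - c / 2)]

lemma integral_beta {a b : ℝ} (ha : 0 < a) (hb : 0 < b) :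
    IntervalIntegrable (fun x : ℝ => x ^ (a - 1) * (1 - x) ^ (b - 1)) volume 0 1 ∧
    ∫ x in (0 : ℝ)..1, x ^ (a - 1) * (1 - x) ^ (b - 1) = ProbabilityTheory.beta a b := by
  have hi := Complex.betaIntegral_convergent (u := a) (v := b) (by simpa) (by simpa)
  have e : ∀ x ∈ Ioc (0 : ℝ) 1, ((x : ℂ) ^ ((a : ℂ) - 1) * (1 - (x : ℂ)) ^ ((b : ℂ) - 1)) =
      ((x ^ (a - 1) * (1 - x) ^ (b - 1) : ℝ) : ℂ) := by
    intro x hx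
    rw [Complex.ofReal_mul, Complex.ofReal_cpow hx.1.le, Complex.ofReal_cpow (by linarith [hx.2])]
    push_cast; rfl
  rw [intervalIntegrable_iff_integrableOn_Ioc_of_le zero_le_one] at hi ⊢
  have hi' := hi.congr_fun e measurableSet_Ioc
  refine ⟨by simpa [IntegrableOn] using hi'.re, ?_⟩
  rw [ProbabilityTheory.beta_eq_betaIntegralReal a b ha hb, Complex.betaIntegral,
    intervalIntegral.integral_of_le zero_le_one, intervalIntegral.integral_of_le zero_le_one,
    setIntegral_congr_fun measurableSet_Ioc e, integral_complex_ofReal, Complex.ofReal_re]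

lemma integral_one_sub_posPow {s δ : ℝ} (hs : s ∈ Ioo (0 : ℝ) 1) (hδ0 : 0 < δ) (hδ1 : δ < 1) :
    ∫ y in Ioi δ, (1 - posPow s (1 - y)) * y ^ (-1 - s) =
      (1 - (1 - δ) ^ s) * δ ^ (-s) / s + ∫ y in δ..1, y ^ ((1 - s) - 1) * (1 - y) ^ (s - 1) := by
  have h1 : s - 1 ≠ 0 := by linarith [hs.2]
  have hs0 := hs.1.ne'
  set f : ℝ → ℝ := fun y => (1 - posPow s (1 - y)) * y ^ (-1 - s) with hf
  have hcont : Continuous fun y => posPow s (1 - y) :=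
    (continuous_posPow hs.1.le).comp (by fun_prop)
  have hpow : ∀ p : ℝ, ContinuousOn (fun y : ℝ => y ^ p) (Icc δ 1) := fun p y hy =>
    (Real.continuousAt_rpow_const _ _ (Or.inl (hδ0.trans_le hy.1).ne')).continuousWithinAt
  have hfc : ContinuousOn f (Icc δ 1) := (continuous_const.sub hcont).continuousOn.mul (hpow _)
  have hfi : IntervalIntegrable f volume δ 1 := by
    apply ContinuousOn.intervalIntegrable; rwa [uIcc_of_le hδ1.le]
  have hbi : IntervalIntegrable (fun y : ℝ => y ^ ((1 - s) - 1) * (1 - y) ^ (s - 1))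
      volume δ 1 := by
    refine (integral_beta (a := 1 - s) (b := s) (by linarith [hs.2]) hs.1).1.mono_set ?_
    rw [uIcc_of_le hδ1.le, uIcc_of_le zero_le_one]
    exact Icc_subset_Icc_left hδ0.le
  have htail : ∀ y ∈ Ioi (1 : ℝ), y ^ (-1 - s) = f y := by
    intro y hy
    simp only [hf]
    rw [posPow_of_nonpos hs0 (by linarith [mem_Ioi.1 hy]), sub_zero, one_mul]
  have hti : IntegrableOn f (Ioi 1) :=
    (integrableOn_Ioi_rpow_of_lt (a := -1 - s) (by linarith [hs.1]) one_pos).congr_fun htail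
      measurableSet_Ioi
  have htv : ∫ y in Ioi (1 : ℝ), f y = 1 / s := by
    rw [← setIntegral_congr_fun measurableSet_Ioi htail,
      integral_Ioi_rpow_of_lt (by linarith [hs.1]) one_pos, Real.one_rpow]
    rw [show -1 - s + 1 = -s by ring, neg_div_neg_eq]
  have hparts : ∫ y in δ..1, (f y - y ^ ((1 - s) - 1) * (1 - y) ^ (s - 1)) =
      -(1 - posPow s (1 - 1)) * (1 : ℝ) ^ (-s) / s -
        -(1 - posPow s (1 - δ)) * δ ^ (-s) / s := by
    refine integral_eq_of_hasDerivAt_off_countable_of_le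
      (fun y => -(1 - posPow s (1 - y)) * y ^ (-s) / s) _ hδ1.le countable_empty ?_ ?_
      (hfi.sub hbi)
    · exact (((continuous_const.sub hcont).neg).continuousOn.mul (hpow _)).div_const _
    · intro y hy
      have hy0 : 0 < y := hδ0.trans hy.1.1
      have hy1 : 0 < 1 - y := by linarith [hy.1.2]
      have d1 := ((hasDerivAt_posPow hs0 h1 hy1.ne').comp y
        ((hasDerivAt_id y).const_sub 1)).const_sub 1 |>.neg
      have d2 := (d1.mul (Real.hasDerivAt_rpow_const (p := -s) (Or.inl hy0.ne'))).div_const s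
      refine d2.congr_deriv ?_
      simp only [hf, Function.comp_apply]
      rw [posPow_of_nonneg (s - 1) hy1.le, show -s - 1 = -1 - s by ring,
        show 1 - s - 1 = -s by ring]
      field_simp
      simp
      ring
  rw [intervalIntegral.integral_sub hfi hbi, sub_self, posPow_of_nonpos hs0 le_rfl,
    posPow_of_nonneg s (by linarith : 0 ≤ 1 - δ), Real.one_rpow] at hparts
  have hsplit := intervalIntegral.integral_interval_add_Ioi' hfi hti
  rw [← hsplit, htv]
  have := sub_eq_iff_eq_add.1 hparts
  rw [this]
  ring

lemma tendsto_integral_one_sub_posPow {s : ℝ} (hs : s ∈ Ioo (0 : ℝ) 1) :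
    Tendsto (fun δ => ∫ y in Ioi δ, (1 - posPow s (1 - y)) * y ^ (-1 - s))
      (nhdsWithin 0 (Ioi 0)) (nhds (Real.Gamma (1 - s) * Real.Gamma s)) := by
  obtain ⟨hbi, hbv⟩ := integral_beta (a := 1 - s) (b := s) (by linarith [hs.2]) hs.1
  rw [ProbabilityTheory.beta, sub_add_cancel, Real.Gamma_one, div_one] at hbv
  have hev : ∀ᶠ δ in nhdsWithin (0 : ℝ) (Ioi 0), δ ∈ Ioo (0 : ℝ) 1 :=
    Ioo_mem_nhdsGT one_pos
  have t1 : Tendsto (fun δ : ℝ => (1 - (1 - δ) ^ s) * δ ^ (-s) / s)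
      (nhdsWithin 0 (Ioi 0)) (nhds 0) := by
    have hlim : Tendsto (fun δ : ℝ => δ ^ (1 - s) / s) (nhdsWithin 0 (Ioi 0)) (nhds 0) := by
      have hc : ContinuousAt (fun δ : ℝ => δ ^ (1 - s) / s) 0 :=
        (Real.continuousAt_rpow_const _ _ (Or.inr (by linarith [hs.2]))).div_const _
      have := hc.tendsto
      rw [Real.zero_rpow (by linarith [hs.2]), zero_div] at this
      exact this.mono_left nhdsWithin_le_nhds
    refine squeeze_zero' ?_ ?_ hlim
    · filter_upwards [hev] with δ hδ
      have := Real.rpow_le_one (by linarith [hδ.2] : 0 ≤ 1 - δ) (by linarith [hδ.1]) hs.1.le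
      exact div_nonneg (mul_nonneg (by linarith) (Real.rpow_nonneg hδ.1.le _)) hs.1.le
    · filter_upwards [hev] with δ hδ
      refine div_le_div_of_nonneg_right ?_ hs.1.le
      have h1 : 1 - δ ≤ (1 - δ) ^ s := by
        simpa using Real.rpow_le_rpow_of_exponent_ge (by linarith [hδ.2] : 0 < 1 - δ)
          (by linarith [hδ.1]) hs.2.le
      rw [sub_eq_add_neg 1 s, Real.rpow_add hδ.1, Real.rpow_one]
      exact mul_le_mul_of_nonneg_right (by linarith) (Real.rpow_nonneg hδ.1.le _)
  have t2 : Tendsto (fun δ : ℝ => ∫ y in δ..1, y ^ ((1 - s) - 1) * (1 - y) ^ (s - 1))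
      (nhdsWithin 0 (Ioi 0)) (nhds (Real.Gamma (1 - s) * Real.Gamma s)) := by
    have hc := intervalIntegral.continuousOn_primitive_interval_left (a := 0) (b := 1)
      (μ := volume) (f := fun y : ℝ => y ^ ((1 - s) - 1) * (1 - y) ^ (s - 1))
      (by rw [uIcc_of_le zero_le_one, integrableOn_Icc_iff_integrableOn_Ioc]; exact hbi.1)
    have h0 := (hc 0 left_mem_uIcc).tendsto
    rw [hbv, uIcc_of_le zero_le_one] at h0
    refine h0.mono_left (nhdsWithin_le_of_mem ?_)
    filter_upwards [hev] with δ hδ using ⟨hδ.1.le, hδ.2.le⟩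
  have := t1.add t2
  rw [zero_add] at this
  refine this.congr' ?_
  filter_upwards [hev] with δ hδ using (integral_one_sub_posPow hs hδ.1 hδ.2).symm

lemma integral_Ioi_sub_posPow {s D ε : ℝ} (hD : 0 < D) (hε : 0 < ε) :
    ∫ r in Ioi ε, (D ^ s - posPow s (D - r ^ 2)) * r ^ (-1 - 2 * s) =
      2⁻¹ * ∫ y in Ioi (ε ^ 2 / D), (1 - posPow s (1 - y)) * y ^ (-1 - s) := by
  have h1 := integral_comp_rpow_Ioi_of_pos'
    (g := fun z => (1 - posPow s (1 - D⁻¹ * z)) * (D⁻¹ * z) ^ (-1 - s))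
    (p := 2) (by norm_num) (c := ε ^ 2) (by positivity)
  rw [integral_comp_mul_left_Ioi (fun y => (1 - posPow s (1 - y)) * y ^ (-1 - s)) _
    (inv_pos.2 hD), inv_inv, smul_eq_mul, mul_comm D⁻¹, ← div_eq_mul_inv] at h1
  have e0 : (ε ^ 2) ^ (2⁻¹ : ℝ) = ε := by
    rw [← Real.rpow_natCast, ← Real.rpow_mul hε.le]; norm_num
  rw [e0] at h1
  have h2 : ∫ y in Ioi (ε ^ 2 / D), (1 - posPow s (1 - y)) * y ^ (-1 - s) =
      D⁻¹ * (D * ∫ y in Ioi (ε ^ 2 / D), (1 - posPow s (1 - y)) * y ^ (-1 - s)) := by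
    rw [inv_mul_cancel_left₀ hD.ne']
  rw [h2, ← h1, ← integral_const_mul, ← integral_const_mul]
  refine setIntegral_congr_fun measurableSet_Ioi fun r hr => ?_
  have hr0 : 0 < r := hε.trans hr
  have e1 : D - r ^ 2 = D * (1 - D⁻¹ * r ^ 2) := by field_simp
  have e2 : (r ^ (2 : ℝ)) = r ^ 2 := by norm_cast
  have e3 : (D⁻¹ * r ^ 2) ^ (-1 - s) = D * D ^ s * (r ^ (-1 - 2 * s) * r⁻¹) := by
    rw [Real.mul_rpow (by positivity) (by positivity), Real.inv_rpow hD.le,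
      ← Real.rpow_neg hD.le, ← e2, ← Real.rpow_mul hr0.le, ← Real.rpow_neg_one r,
      ← Real.rpow_add hr0, show -(-1 - s) = 1 + s by ring, Real.rpow_add hD, Real.rpow_one]
    congr 2; ring
  simp only [smul_eq_mul, e2]
  rw [e3, e1, posPow_mul hD.le, show (2 : ℝ) - 1 = 1 by norm_num, Real.rpow_one]
  field_simp

/-- The radial part of the principal value. -/
lemma tendsto_integral_Ioi_sub_posPow {s D : ℝ} (hs : s ∈ Ioo (0 : ℝ) 1) (hD : 0 < D) :
    Tendsto (fun ε => ∫ r in Ioi ε, (D ^ s - posPow s (D - r ^ 2)) * r ^ (-1 - 2 * s))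
      (nhdsWithin 0 (Ioi 0)) (nhds (2⁻¹ * (Real.Gamma (1 - s) * Real.Gamma s))) := by
  have ht : Tendsto (fun ε : ℝ => ε ^ 2 / D) (nhdsWithin 0 (Ioi 0)) (nhdsWithin 0 (Ioi 0)) := by
    refine tendsto_nhdsWithin_iff.2 ⟨?_, ?_⟩
    · have hc : Continuous fun ε : ℝ => ε ^ 2 / D := by fun_prop
      have := hc.tendsto 0
      simp only [ne_eq, OfNat.ofNat_ne_zero, not_false_eq_true, zero_pow, zero_div] at this
      exact this.mono_left nhdsWithin_le_nhds
    · filter_upwards [self_mem_nhdsWithin] with ε (hε : 0 < ε)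
      exact div_pos (by positivity) hD
  refine (((tendsto_integral_one_sub_posPow hs).comp ht).const_mul 2⁻¹).congr' ?_
  filter_upwards [self_mem_nhdsWithin] with ε hε using (integral_Ioi_sub_posPow hD hε).symm

section Polar

variable {E : Type*} [NormedAddCommGroup E]

lemma abs_integral_le_of_abs_integral_ray_le [NormedSpace ℝ E] [FiniteDimensional ℝ E]
    [Nontrivial E] [MeasurableSpace E] [BorelSpace E] (μ : Measure E) [μ.IsAddHaarMeasure]
    {f : E → ℝ} (hf : Integrable f μ) {B : ℝ}
    (hB : ∀ θ : E, ‖θ‖ = 1 →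
      |∫ r in Ioi (0 : ℝ), r ^ (Module.finrank ℝ E - 1) * f (r • θ)| ≤ B) :
    |∫ x, f x ∂μ| ≤ Module.finrank ℝ E * μ.real (Metric.ball 0 1) * B := by
  have hmp := μ.measurePreserving_homeomorphUnitSphereProd
  have hme := (homeomorphUnitSphereProd E).measurableEmbedding
  set F : Metric.sphere (0 : E) 1 × Ioi (0 : ℝ) → ℝ := fun p => f (p.2.1 • p.1.1) with hF
  have hFc : ∀ z : ({0}ᶜ : Set E), F (homeomorphUnitSphereProd E z) = f z := by
    intro z
    have : (z : E) ≠ 0 := z.2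
    simp [hF, homeomorphUnitSphereProd, smul_smul, norm_ne_zero_iff.2 this]
  have h0 : MeasurableSet ({0}ᶜ : Set E) := (measurableSet_singleton _).compl
  have hint : ∫ x, f x ∂μ = ∫ p, F p ∂(μ.toSphere.prod (.volumeIoiPow (Module.finrank ℝ E - 1))) := by
    rw [← hmp.integral_comp hme F]
    simp only [hFc]
    rw [integral_subtype_comap h0 f, restrict_compl_singleton]
  have hFi : Integrable F (μ.toSphere.prod (.volumeIoiPow (Module.finrank ℝ E - 1))) := by
    rw [← hmp.integrable_comp_emb hme]
    have : F ∘ homeomorphUnitSphereProd E = f ∘ Subtype.val := funext hFc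
    rw [this, ← integrableOn_iff_comap_subtypeVal h0]
    exact hf.integrableOn
  have hray : ∀ θ : Metric.sphere (0 : E) 1,
      ∫ r, F (θ, r) ∂(.volumeIoiPow (Module.finrank ℝ E - 1)) =
      ∫ r in Ioi (0 : ℝ), r ^ (Module.finrank ℝ E - 1) * f (r • θ.1) := by
    intro θ
    simp only [Measure.volumeIoiPow, ENNReal.ofReal]
    rw [integral_withDensity_eq_integral_smul,
      integral_subtype_comap measurableSet_Ioi
        fun a : ℝ => Real.toNNReal (a ^ (Module.finrank ℝ E - 1)) • f (a • θ.1)]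
    · refine setIntegral_congr_fun measurableSet_Ioi fun r hr => ?_
      simp only [NNReal.smul_def, Real.coe_toNNReal _ (pow_nonneg (le_of_lt (mem_Ioi.1 hr)) _),
        smul_eq_mul]
    · exact (measurable_subtype_coe.pow_const _).real_toNNReal
  rw [hint, integral_prod _ hFi, ← μ.toSphere_real_apply_univ, ← Real.norm_eq_abs]
  refine (norm_integral_le_of_norm_le_const (μ := μ.toSphere) (C := B)
    (f := fun θ => ∫ r, F (θ, r) ∂(.volumeIoiPow (Module.finrank ℝ E - 1)))
    (ae_of_all _ fun θ => ?_)).trans_eq (mul_comm _ _)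
  rw [hray, Real.norm_eq_abs]
  exact hB _ (by simp)

variable [InnerProductSpace ℝ E] [FiniteDimensional ℝ E] [Nontrivial E] [MeasurableSpace E]
  [BorelSpace E]

/-- The truncated kernel of the fractional Laplacian as a function of the radius. -/
def truncKernel (n : ℕ) (s ε r : ℝ) : ℝ := (Ioi ε).indicator (fun r => (r ^ ((n : ℝ) + 2 * s))⁻¹) r

lemma pow_mul_truncKernel {n : ℕ} (hn : 1 ≤ n) (s : ℝ) {ε r : ℝ} (hr : 0 < r) :
    r ^ (n - 1) * truncKernel n s ε r = (Ioi ε).indicator (fun r => r ^ (-1 - 2 * s)) r := by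
  by_cases h : r ∈ Ioi ε
  · rw [truncKernel, indicator_of_mem h, indicator_of_mem h, ← Real.rpow_natCast, ← Real.rpow_neg hr.le,
      ← Real.rpow_add hr, Nat.cast_sub hn]
    congr 1; push_cast; ring
  · rw [truncKernel, indicator_of_notMem h, indicator_of_notMem h, mul_zero]

lemma setIntegral_pow_mul_truncKernel {n : ℕ} (hn : 1 ≤ n) (s : ℝ) {ε : ℝ} (hε : 0 < ε)
    (φ : ℝ → ℝ) :
    ∫ r in Ioi (0 : ℝ), r ^ (n - 1) * (truncKernel n s ε r * φ r) =
      ∫ r in Ioi ε, φ r * r ^ (-1 - 2 * s) := by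
  rw [← inter_eq_right.2 (Ioi_subset_Ioi hε.le), ← setIntegral_indicator measurableSet_Ioi]
  refine setIntegral_congr_fun measurableSet_Ioi fun r hr => ?_
  rw [← mul_assoc, pow_mul_truncKernel hn s (mem_Ioi.1 hr)]
  by_cases h : r ∈ Ioi ε
  · rw [indicator_of_mem h, indicator_of_mem h, mul_comm]
  · rw [indicator_of_notMem h, indicator_of_notMem h, zero_mul]

lemma integrable_truncKernel_norm {s ε : ℝ} (hs : 0 < s) (hε : 0 < ε) :
    Integrable (fun z : E => truncKernel (Module.finrank ℝ E) s ε ‖z‖) := by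
  rw [integrable_fun_norm_addHaar (volume : Measure E)]
  have h := (integrableOn_Ioi_rpow_of_lt (a := -1 - 2 * s) (by linarith) hε)
  rw [← integrable_indicator_iff measurableSet_Ioi] at h
  refine h.integrableOn.congr_fun (fun r hr => ?_) measurableSet_Ioi
  exact (pow_mul_truncKernel Module.finrank_pos s (mem_Ioi.1 hr)).symm

lemma integrable_truncKernel_mul_posPow {s D ε : ℝ} (hs : 0 < s) (hε : 0 < ε) (v : E) :
    Integrable (fun z : E => truncKernel (Module.finrank ℝ E) s ε ‖z‖ *
      posPow s (D + 2 * inner ℝ v z - ‖z‖ ^ 2)) := by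
  refine (integrable_truncKernel_norm hs hε).mul_bdd (c := posPow s (D + ‖v‖ ^ 2)) ?_ ?_
  · exact ((continuous_posPow hs.le).comp (by fun_prop)).aestronglyMeasurable
  · refine ae_of_all _ fun z => ?_
    rw [Real.norm_of_nonneg (posPow_nonneg _ _)]
    refine posPow_le_posPow hs.le ?_
    have := norm_sub_sq_real v z
    nlinarith [sq_nonneg ‖v - z‖]

lemma abs_integral_truncKernel_symm_le {s D ε : ℝ} (hs : s ∈ Ioo (0 : ℝ) 1) (hD : 0 < D)
    {x : E} (hx : ‖x‖ ≤ 1) (hε : 0 < ε) (hT : 1 / D ≤ 1 / ε)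
    (hQ : 0 < D * (1 / ε - 1 / D) ^ 2 - (1 + 1 / D)) :
    |∫ z : E, truncKernel (Module.finrank ℝ E) s ε ‖z‖ *
      (posPow s (D + 2 * inner ℝ x z - ‖z‖ ^ 2) + posPow s (D + 2 * inner ℝ (-x) z - ‖z‖ ^ 2) -
        2 * posPow s (D + 2 * inner ℝ (0 : E) z - ‖z‖ ^ 2))| ≤
      Module.finrank ℝ E * (volume : Measure E).real (Metric.ball 0 1) *
        (4 / D * (D * (1 / ε - 1 / D) ^ 2 - (1 + 1 / D)) ^ (s - 1)) := by
  have hi := integrable_truncKernel_mul_posPow (E := E) (D := D) hs.1 hε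
  refine abs_integral_le_of_abs_integral_ray_le volume ?_ fun θ hθ => ?_
  · refine (((hi x).add (hi (-x))).sub ((hi 0).const_mul 2)).congr (ae_of_all _ fun z => ?_)
    simp only [Pi.add_apply, Pi.sub_apply]
    ring
  have hc : |2 * inner ℝ x θ| ≤ 2 := by
    rw [abs_mul, abs_two]
    have := abs_real_inner_le_norm x θ
    rw [hθ, mul_one] at this
    linarith
  set c := 2 * inner ℝ x θ with hcdef
  have e : ∫ r in Ioi (0 : ℝ), r ^ (Module.finrank ℝ E - 1) *
      (truncKernel (Module.finrank ℝ E) s ε ‖r • θ‖ *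
      (posPow s (D + 2 * inner ℝ x (r • θ) - ‖r • θ‖ ^ 2) +
        posPow s (D + 2 * inner ℝ (-x) (r • θ) - ‖r • θ‖ ^ 2) -
        2 * posPow s (D + 2 * inner ℝ (0 : E) (r • θ) - ‖r • θ‖ ^ 2))) =
      chordIntegral s D (1 / ε) c + chordIntegral s D (1 / ε) (-c) -
        2 * chordIntegral s D (1 / ε) 0 := by
    have hj := fun c => integrableOn_posPow_mul_rpow hs.1 D c hε
    have hj2 : IntegrableOn (fun r => posPow s (D + c * r - r ^ 2) * r ^ (-1 - 2 * s) +
        posPow s (D + -c * r - r ^ 2) * r ^ (-1 - 2 * s)) (Ioi ε) := (hj _).add (hj _)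
    rw [← integral_Ioi_posPow_eq_chordIntegral _ _ _ hε,
      ← integral_Ioi_posPow_eq_chordIntegral _ _ _ hε,
      ← integral_Ioi_posPow_eq_chordIntegral _ _ _ hε, ← integral_add (hj _) (hj _),
      ← integral_const_mul, ← integral_sub hj2 ((hj _).const_mul 2)]
    rw [show (∫ r in Ioi ε, (posPow s (D + c * r - r ^ 2) * r ^ (-1 - 2 * s) +
        posPow s (D + -c * r - r ^ 2) * r ^ (-1 - 2 * s) -
        2 * (posPow s (D + 0 * r - r ^ 2) * r ^ (-1 - 2 * s)))) =
        ∫ r in Ioi ε, (posPow s (D + c * r - r ^ 2) + posPow s (D + -c * r - r ^ 2) -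
        2 * posPow s (D + 0 * r - r ^ 2)) * r ^ (-1 - 2 * s) by congr 1; ext r; ring,
      ← setIntegral_pow_mul_truncKernel (n := Module.finrank ℝ E) Module.finrank_pos s hε]
    refine setIntegral_congr_fun measurableSet_Ioi fun r hr => ?_
    have hn : ‖r • θ‖ = r := by rw [norm_smul, hθ, mul_one, Real.norm_of_nonneg (le_of_lt hr)]
    simp only [hn, inner_neg_left, inner_smul_right, inner_zero_left, hcdef]
    congr 6 <;> ring
  rw [e]
  exact abs_chordIntegral_symm_le hs hD hc hT hQ

lemma integral_truncKernel_radial {s D ε : ℝ} (hε : 0 < ε) :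
    ∫ z : E, truncKernel (Module.finrank ℝ E) s ε ‖z‖ * (D ^ s - posPow s (D - ‖z‖ ^ 2)) =
      Module.finrank ℝ E * (volume : Measure E).real (Metric.ball 0 1) *
        ∫ r in Ioi ε, (D ^ s - posPow s (D - r ^ 2)) * r ^ (-1 - 2 * s) := by
  rw [integral_fun_norm_addHaar volume
    fun r => truncKernel (Module.finrank ℝ E) s ε r * (D ^ s - posPow s (D - r ^ 2))]
  simp only [smul_eq_mul, nsmul_eq_mul]
  rw [setIntegral_pow_mul_truncKernel Module.finrank_pos s hε, mul_assoc]

lemma tendsto_integral_truncKernel {s : ℝ} (hs : s ∈ Ioo (0 : ℝ) 1) {x : E} (hx : ‖x‖ < 1) :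
    Tendsto (fun ε => ∫ z : E, truncKernel (Module.finrank ℝ E) s ε ‖z‖ *
        (posPow s (1 - ‖x‖ ^ 2) - posPow s (1 - ‖x - z‖ ^ 2)))
      (nhdsWithin 0 (Ioi 0))
      (nhds (Module.finrank ℝ E * (volume : Measure E).real (Metric.ball 0 1) *
        (2⁻¹ * (Real.Gamma (1 - s) * Real.Gamma s)))) := by
  set D := 1 - ‖x‖ ^ 2 with hDdef
  have hD : 0 < D := by nlinarith [norm_nonneg x]
  set V := Module.finrank ℝ E * (volume : Measure E).real (Metric.ball 0 1) with hV
  set Q : ℝ → ℝ := fun ε => D * (1 / ε - 1 / D) ^ 2 - (1 + 1 / D) with hQ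
  set k : ℝ → E → ℝ := fun ε z => truncKernel (Module.finrank ℝ E) s ε ‖z‖ with hk
  set p : E → E → ℝ := fun v z => posPow s (D + 2 * inner ℝ v z - ‖z‖ ^ 2) with hp
  have hinv : Tendsto (fun ε : ℝ => 1 / ε) (nhdsWithin 0 (Ioi 0)) atTop := by
    simpa using tendsto_inv_nhdsGT_zero (𝕜 := ℝ)
  have hQt : Tendsto Q (nhdsWithin 0 (Ioi 0)) atTop := by
    refine tendsto_atTop_add_const_right _ _ (Tendsto.const_mul_atTop hD ?_)
    exact (tendsto_pow_atTop two_ne_zero).comp (tendsto_atTop_add_const_right _ _ hinv)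
  have hη : Tendsto (fun ε => V * (4 / D * Q ε ^ (s - 1))) (nhdsWithin 0 (Ioi 0)) (nhds 0) := by
    have h := (tendsto_rpow_neg_atTop (y := 1 - s) (by linarith [hs.2])).comp hQt
    simpa using (h.const_mul (4 / D)).const_mul V
  have hE : Tendsto (fun ε => ∫ z, k ε z * (p x z + p (-x) z - 2 * p 0 z))
      (nhdsWithin 0 (Ioi 0)) (nhds 0) := by
    refine squeeze_zero_norm' ?_ hη
    filter_upwards [self_mem_nhdsWithin, hinv.eventually_ge_atTop (1 / D),
      hQt.eventually_gt_atTop 0] with ε hε h1 h2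
    exact abs_integral_truncKernel_symm_le hs hD hx.le hε h1 h2
  have hR := (tendsto_integral_Ioi_sub_posPow hs hD).const_mul V
  have := hR.sub (hE.const_mul 2⁻¹)
  rw [mul_zero, sub_zero] at this
  refine this.congr' ?_
  filter_upwards [self_mem_nhdsWithin] with ε (hε : 0 < ε)
  have hi : ∀ v, Integrable (fun z => k ε z * p v z) := integrable_truncKernel_mul_posPow hs.1 hε
  have hiD : Integrable (fun z => k ε z * D ^ s) := (integrable_truncKernel_norm hs.1 hε).mul_const _
  have hsymm : ∫ z, k ε z * p (-x) z = ∫ z, k ε z * p x z := by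
    rw [← integral_neg_eq_self]
    simp only [hk, hp, norm_neg, inner_neg_neg]
  have hp0 : ∀ z, p 0 z = posPow s (D - ‖z‖ ^ 2) := fun z => by
    simp only [hp, inner_zero_left, mul_zero, add_zero]
  have hpx : ∀ z, posPow s (1 - ‖x - z‖ ^ 2) = p x z := fun z => by
    simp only [hp, hDdef, norm_sub_sq_real]; congr 1; ring
  have e1 : ∫ z, k ε z * (p x z + p (-x) z - 2 * p 0 z) =
      2 * (∫ z, k ε z * p x z) - 2 * ∫ z, k ε z * p 0 z := by
    have : ∀ z, k ε z * (p x z + p (-x) z - 2 * p 0 z) =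
        (k ε z * p x z + k ε z * p (-x) z) - 2 * (k ε z * p 0 z) := fun z => by ring
    simp only [this]
    have hadd : Integrable (fun z => k ε z * p x z + k ε z * p (-x) z) := (hi _).add (hi _)
    rw [integral_sub hadd ((hi _).const_mul 2), integral_add (hi _) (hi _), hsymm,
      integral_const_mul]
    ring
  have e2 := integral_truncKernel_radial (E := E) (s := s) (D := D) hε
  rw [← hV] at e2
  simp only [← hp0, mul_sub] at e2
  rw [integral_sub hiD (hi 0)] at e2
  have e3 : ∫ z, k ε z * (posPow s D - posPow s (1 - ‖x - z‖ ^ 2)) =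
      (∫ z, k ε z * D ^ s) - ∫ z, k ε z * p x z := by
    simp only [hpx, mul_sub, posPow_of_nonneg s hD.le]
    exact integral_sub hiD (hi x)
  rw [e1, e3]
  simp only [hp0] at e2 ⊢
  linarith

end Polar

lemma Cds_mul_getoorFun_const {d : ℕ} (hd : 1 ≤ d) {s : ℝ} (hs : s ∈ Ioo (0 : ℝ) 1) :
    Cds d s * (Real.Gamma (d / 2) /
      (2 ^ (2 * s) * Real.Gamma ((d + 2 * s) / 2) * Real.Gamma (1 + s)) *
      (d * (volume : Measure (EuclideanSpace ℝ (Fin d))).real (Metric.ball 0 1) *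
        (2⁻¹ * (Real.Gamma (1 - s) * Real.Gamma s)))) = 1 := by
  have : Nonempty (Fin d) := ⟨⟨0, hd⟩⟩
  have hd0 : (0 : ℝ) < d := by exact_mod_cast hd
  have hs0 := hs.1
  have hv : (volume : Measure (EuclideanSpace ℝ (Fin d))).real (Metric.ball 0 1) =
      Real.pi ^ ((d : ℝ) / 2) / ((d / 2) * Real.Gamma (d / 2)) := by
    rw [Measure.real, EuclideanSpace.volume_ball, ← Real.Gamma_add_one (by positivity)]
    simp only [ENNReal.ofReal_one, one_pow, one_mul, Fintype.card_fin]
    rw [ENNReal.toReal_ofReal (by positivity), Real.sqrt_eq_rpow, ← Real.rpow_natCast,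
      ← Real.rpow_mul Real.pi_pos.le]
    congr 2; ring
  have g1 := (Real.Gamma_pos_of_pos (half_pos hd0)).ne'
  have g2 := (Real.Gamma_pos_of_pos (by positivity : 0 < s + (d : ℝ) / 2)).ne'
  have g3 := (Real.Gamma_pos_of_pos (by linarith [hs.2] : 0 < 1 - s)).ne'
  have g4 := (Real.Gamma_pos_of_pos hs0).ne'
  have g5 : (2 : ℝ) ^ (2 * s) ≠ 0 := by positivity
  have g6 : Real.pi ^ ((d : ℝ) / 2) ≠ 0 := by positivity
  rw [hv, Cds, show ((d : ℝ) + 2 * s) / 2 = s + d / 2 by ring, add_comm 1 s,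
    Real.Gamma_add_one hs0.ne']
  field_simp

/-- Getoor's example: with `u(x) = λ (1-|x|²)₊^s`,
`λ = Γ(d/2)/(2^{2s} Γ((d+2s)/2) Γ(1+s))`, for every `x` in the open unit ball the principal
value `C_{d,s} lim_{ε→0⁺} ∫_{|x-y|>ε} (u(x)-u(y))/|x-y|^{d+2s} dy` exists and equals `1`;
note that `u = 0` outside the unit ball. -/
theorem getoor_solution (d : ℕ) (hd : 1 ≤ d) (s : ℝ) (hs : s ∈ Set.Ioo (0 : ℝ) 1) :
    ∀ x ∈ Metric.ball (0 : EuclideanSpace ℝ (Fin d)) 1,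
      Tendsto (fun ε : ℝ =>
          Cds d s * ∫ y in {y : EuclideanSpace ℝ (Fin d) | ε < ‖x - y‖},
            (getoorFun d s x - getoorFun d s y) / ‖x - y‖ ^ ((d : ℝ) + 2 * s))
        (nhdsWithin 0 (Set.Ioi 0)) (nhds 1) := by
  intro x hx
  have hx1 : ‖x‖ < 1 := by simpa using hx
  have : Nonempty (Fin d) := ⟨⟨0, hd⟩⟩
  have hlim := tendsto_integral_truncKernel hs hx1
  rw [finrank_euclideanSpace_fin] at hlim
  set Λ := Real.Gamma (d / 2) /
    (2 ^ (2 * s) * Real.Gamma ((d + 2 * s) / 2) * Real.Gamma (1 + s)) with hΛ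
  have h := (hlim.const_mul Λ).const_mul (Cds d s)
  rw [hΛ, Cds_mul_getoorFun_const hd hs, ← hΛ] at h
  refine h.congr fun ε => ?_
  congr 1
  have hm : MeasurableSet {y : EuclideanSpace ℝ (Fin d) | ε < ‖x - y‖} :=
    measurableSet_lt measurable_const (by fun_prop)
  rw [← integral_const_mul, ← integral_indicator hm,
    ← integral_sub_left_eq_self ({y | ε < ‖x - y‖}.indicator _) volume x]
  refine integral_congr_ae (ae_of_all _ fun z => ?_)
  beta_reduce
  by_cases hz : ε < ‖z‖
  · rw [indicator_of_mem (show x - z ∈ {y | ε < ‖x - y‖} by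
      rwa [mem_ofPred_eq, _root_.sub_sub_cancel]), truncKernel, indicator_of_mem (show ‖z‖ ∈ Ioi ε from hz)]
    simp only [getoorFun, ← hΛ, posPow, _root_.sub_sub_cancel]
    ring
  · rw [indicator_of_notMem (show x - z ∉ {y | ε < ‖x - y‖} by
      rwa [mem_ofPred_eq, _root_.sub_sub_cancel]), truncKernel,
      indicator_of_notMem (show ‖z‖ ∉ Ioi ε from hz)]
    simp
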